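/- arXiv:2310.05982 — 2 statements merged into one kernel-verified Lean document; each statement's English description precedes it below -/
import Mathlib

section
/- Let F be a field, m, n natural numbers, and A an m×n matrix over F. Let C = χ · S, where S is the (m+n)×(m+n) symmetric block matrix [[0, A],[Aᵀ, 0]] with entries embedded into the rational function field F(X), and χ is the (m+n)×(m+n) diagonal matrix over F(X) with diagonal entries X^0, X^1, …, X^{m+n−1}. Then the multiplicity of 0 as a root of the characteristic polynomial of C (over F(X)) equals m + n − 2·rank(A). Equivalently, the output of Mulmuley's algorithm, (m + n − rootMultiplicity 0 (charpoly C))/2, equals the rank of A. -/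
open Matrix Polynomial

/-- The rank of a square matrix is unchanged under field extension. -/
lemma aux_rank_map {F K ι : Type*} [Field F] [Field K] [Fintype ι] [DecidableEq ι]
    (f : F →+* K) (M : Matrix ι ι F) : (M.map f).rank = M.rank := by
  classical
  obtain ⟨V, U, e, hV, hU, h⟩ := M.exists_rank_normal_form
  have hV' : IsUnit (V.map f).det := by
    rw [← RingHom.mapMatrix_apply, ← RingHom.map_det]
    exact ((isUnit_iff_isUnit_det _).1 hV).map f
  have hU' : IsUnit (U.map f).det := by
    rw [← RingHom.mapMatrix_apply, ← RingHom.map_det]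
    exact ((isUnit_iff_isUnit_det _).1 hU).map f
  have h' := congrArg (fun B => B.map f) h
  simp only [Matrix.map_mul] at h'
  rw [← rank_mul_eq_right_of_isUnit_det _ (M.map f) hV',
    ← rank_mul_eq_left_of_isUnit_det _ _ hU', h', ← Matrix.submatrix_map, rank_submatrix,
    fromBlocks_map, Matrix.map_one _ (map_zero f) (map_one f), Matrix.map_zero _ (map_zero f),
    Matrix.map_zero _ (map_zero f), Matrix.map_zero _ (map_zero f),
    ← diagonal_one, ← diagonal_zero, fromBlocks_diagonal, rank_diagonal,
    Fintype.card_subtype, Finset.card_filter, Fintype.sum_sum_type]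
  simp

lemma aux_rank_blocks {F : Type*} [Field F] {m n : ℕ} (A : Matrix (Fin m) (Fin n) F) :
    (Matrix.fromBlocks 0 A Aᵀ 0).rank = 2 * A.rank := by
  let e := LinearEquiv.sumArrowLequivProdArrow (Fin m) (Fin n) F F
  let g : (LinearMap.ker (Matrix.fromBlocks 0 A Aᵀ 0).mulVecLin) ≃ₗ[F]
      (LinearMap.ker Aᵀ.mulVecLin) × (LinearMap.ker A.mulVecLin) :=
    { toFun := fun x => (⟨x.1 ∘ Sum.inl, by
          have := x.2
          rw [LinearMap.mem_ker, mulVecLin_apply, fromBlocks_mulVec] at this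
          have h := congrArg (fun z => z ∘ Sum.inr) this
          rw [LinearMap.mem_ker, mulVecLin_apply]
          simpa using h⟩, ⟨x.1 ∘ Sum.inr, by
          have := x.2
          rw [LinearMap.mem_ker, mulVecLin_apply, fromBlocks_mulVec] at this
          have h := congrArg (fun z => z ∘ Sum.inl) this
          simpa using h⟩)
      invFun := fun y => ⟨Sum.elim y.1.1 y.2.1, by
          have h1 := y.1.2
          have h2 := y.2.2
          rw [LinearMap.mem_ker, mulVecLin_apply] at h1 h2
          rw [LinearMap.mem_ker, mulVecLin_apply, fromBlocks_mulVec]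
          ext (i | i) <;> simp [h1, h2]⟩
      map_add' := fun x y => rfl
      map_smul' := fun c x => rfl
      left_inv := fun x => by ext (i | i) <;> rfl
      right_inv := fun y => rfl }
  have h0 := g.finrank_eq
  rw [Module.finrank_prod] at h0
  have h1 := (Matrix.fromBlocks 0 A Aᵀ 0).mulVecLin.finrank_range_add_finrank_ker
  have h2 := A.mulVecLin.finrank_range_add_finrank_ker
  have h3 := Aᵀ.mulVecLin.finrank_range_add_finrank_ker
  have h4 := A.rank_transpose
  simp only [Module.finrank_fintype_fun_eq_card, Fintype.card_sum, Fintype.card_fin] at h1 h2 h3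
  unfold Matrix.rank at *
  omega

lemma aux_key {F : Type*} [Field F] {N : ℕ} (S : Matrix (Fin N) (Fin N) F) (hS : Sᵀ = S)
    (v : Fin N → F[X])
    (h : (S.map C) *ᵥ (diagonal (fun i : Fin N => (X : F[X]) ^ (i : ℕ)) *ᵥ
      ((S.map C) *ᵥ v)) = 0) : (S.map C) *ᵥ v = 0 := by
  classical
  set w := (S.map C) *ᵥ v with hw
  by_contra hne
  obtain ⟨j0, hj0⟩ := Function.ne_iff.1 hne
  obtain ⟨j, -, hj⟩ := Finset.exists_max_image Finset.univ (fun i => (w i).degree) ⟨j0, by simp⟩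
  have hwj : w j ≠ 0 := by
    intro h0
    have := hj j0 (Finset.mem_univ _)
    simp only [h0, degree_zero, le_bot_iff, degree_eq_bot] at this
    exact hj0 this
  set d := (w j).natDegree with hd
  have hdeg : ∀ i, (w i).natDegree ≤ d := fun i =>
    natDegree_le_natDegree (hj i (Finset.mem_univ _))
  let y : Fin N → F := fun i => (w i).coeff d
  have hyj : y j ≠ 0 := by simpa [y, hd] using hwj
  obtain ⟨i0, hi0, himax⟩ := Finset.exists_max_image (Finset.univ.filter (fun i => y i ≠ 0)) id
    ⟨j, by simp [hyj]⟩
  have hy0 : y i0 ≠ 0 := (Finset.mem_filter.1 hi0).2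
  let u : Fin N → F := fun i => (v i).coeff d
  have hyu : (fun i => C (u i)) ᵥ* (S.map C) = fun i => C (y i) := by
    have hSt : (S.map C) = ((S.map C)ᵀ : Matrix _ _ F[X]) := by
      rw [← transpose_map, hS]
    rw [hSt, vecMul_transpose]
    ext1 i
    simp [y, u, hw, mulVec, dotProduct, finsetSum_coeff]
  have hrel := congrArg (fun z => (fun i => C (u i)) ⬝ᵥ z) h
  simp only [dotProduct_mulVec _ (S.map C), hyu, dotProduct_zero] at hrel
  have hc := congrArg (fun p : F[X] => p.coeff (d + i0)) hrel
  simp only [dotProduct, mulVec_diagonal, finsetSum_coeff, coeff_C_mul, coeff_zero] at hc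
  rw [Finset.sum_eq_single i0] at hc
  · rw [coeff_X_pow_mul] at hc
    exact mul_ne_zero hy0 hy0 hc
  · intro i _ hi
    by_cases hyi : y i = 0
    · simp [hyi]
    · have hlt : i < i0 := lt_of_le_of_ne (himax i (by simp [hyi])) hi
      have : (X ^ (i : ℕ) * w i).coeff (d + i0) = 0 := by
        have hlt' : (i : ℕ) < i0 := hlt
        rw [coeff_X_pow_mul', if_pos (by omega)]
        apply coeff_eq_zero_of_natDegree_lt
        have := hdeg i
        omega
      rw [this, mul_zero]
  · simp

lemma aux_ker {F : Type*} [Field F] {N : ℕ} (S : Matrix (Fin N) (Fin N) F) (hS : Sᵀ = S)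
    (v : Fin N → RatFunc F)
    (h : (S.map (algebraMap F (RatFunc F))) *ᵥ
      (diagonal (fun i : Fin N => (RatFunc.X : RatFunc F) ^ (i : ℕ)) *ᵥ
      ((S.map (algebraMap F (RatFunc F))) *ᵥ v)) = 0) :
    (S.map (algebraMap F (RatFunc F))) *ᵥ v = 0 := by
  obtain ⟨b, hb⟩ := IsLocalization.exist_integer_multiples_of_finite (nonZeroDivisors F[X]) v
  choose p hp using hb
  let f : F[X] →+* RatFunc F := algebraMap F[X] (RatFunc F)
  have hf : Function.Injective f := IsFractionRing.injective F[X] (RatFunc F)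
  have hb0 : f b ≠ 0 := by
    rw [Ne, map_eq_zero_iff f hf]
    exact nonZeroDivisors.coe_ne_zero b
  have hp' : f ∘ p = f b • v := by
    ext1 i
    simp only [Function.comp, Pi.smul_apply, smul_eq_mul]
    exact (hp i).trans (Algebra.smul_def _ _)
  have hSm : (S.map (algebraMap F (RatFunc F))) = (S.map C).map f := by
    ext i k
    simp [f, RatFunc.algebraMap_C]
  have hD : diagonal (fun i : Fin N => (RatFunc.X : RatFunc F) ^ (i : ℕ)) =
      (diagonal (fun i : Fin N => (X : F[X]) ^ (i : ℕ))).map f := by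
    rw [diagonal_map (map_zero f)]
    congr 1
    ext1 i
    simp [f]
  have hm : ∀ (M : Matrix (Fin N) (Fin N) F[X]) (z : Fin N → F[X]),
      f ∘ (M *ᵥ z) = M.map f *ᵥ (f ∘ z) := fun M z => by
    ext1 i
    exact RingHom.map_mulVec f M z i
  have hz : ∀ z : Fin N → F[X], f ∘ z = 0 → z = 0 := fun z hz => by
    ext1 i
    exact (map_eq_zero_iff f hf).1 (congrFun hz i)
  have key := aux_key S hS p (by
    apply hz
    rw [hm, hm, hm, hp', ← hSm, ← hD, mulVec_smul, mulVec_smul, mulVec_smul, h, smul_zero])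
  have h2 := hm (S.map C) p
  rw [key, hp', ← hSm, mulVec_smul] at h2
  have h3 : f b • (S.map (algebraMap F (RatFunc F)) *ᵥ v) = 0 := by
    rw [← h2]; ext1 i; simp
  exact (smul_eq_zero.1 h3).resolve_left hb0

/-- Mulmuley's algorithm computes the rank: the multiplicity of `0` as a root of the
characteristic polynomial of `C = χ * S` equals `m + n - 2 * rank A`, and hence
`(m + n - rootMultiplicity 0 (charpoly C)) / 2 = rank A`. -/
theorem mulmuley_rank (F : Type*) [Field F] (m n : ℕ) (A : Matrix (Fin m) (Fin n) F)
    (S : Matrix (Fin (m + n)) (Fin (m + n)) (RatFunc F))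
    (hS : S = Matrix.reindex finSumFinEquiv finSumFinEquiv
      ((Matrix.fromBlocks 0 A Aᵀ 0).map (algebraMap F (RatFunc F))))
    (χ : Matrix (Fin (m + n)) (Fin (m + n)) (RatFunc F))
    (hχ : χ = Matrix.diagonal (fun i : Fin (m + n) => (RatFunc.X : RatFunc F) ^ (i : ℕ)))
    (C : Matrix (Fin (m + n)) (Fin (m + n)) (RatFunc F))
    (hC : C = χ * S) :
    Polynomial.rootMultiplicity 0 C.charpoly = m + n - 2 * A.rank ∧
    (m + n - Polynomial.rootMultiplicity 0 C.charpoly) / 2 = A.rank := by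
  set S0 : Matrix (Fin (m + n)) (Fin (m + n)) F :=
    Matrix.reindex finSumFinEquiv finSumFinEquiv (Matrix.fromBlocks 0 A Aᵀ 0) with hS0
  have hSS : S = S0.map (algebraMap F (RatFunc F)) := by rw [hS]; rfl
  have hsym : S0ᵀ = S0 := by
    rw [hS0, transpose_reindex, fromBlocks_transpose]
    simp
  have hdet : IsUnit χ.det := by
    rw [hχ, det_diagonal, isUnit_iff_ne_zero, Finset.prod_ne_zero_iff]
    intro i _
    exact pow_ne_zero _ RatFunc.X_ne_zero
  have hrank : C.rank = 2 * A.rank := by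
    rw [hC, rank_mul_eq_right_of_isUnit_det _ _ hdet, hSS, aux_rank_map, hS0, rank_reindex,
      aux_rank_blocks]
  have hstep : ∀ v, C.mulVecLin (C.mulVecLin v) = 0 → C.mulVecLin v = 0 := by
    intro v hv
    simp only [mulVecLin_apply, hC, ← mulVec_mulVec] at hv ⊢
    have hinj := mulVec_injective_iff_isUnit.2 ((isUnit_iff_isUnit_det _).2 hdet)
    have hv' : S *ᵥ (χ *ᵥ (S *ᵥ v)) = 0 := hinj (by simpa using hv)
    rw [hSS, hχ] at hv'
    rw [hSS, aux_ker S0 hsym v hv', mulVec_zero]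
  have hker : Module.End.maxGenEigenspace C.mulVecLin 0 = LinearMap.ker C.mulVecLin := by
    ext v
    rw [Module.End.mem_maxGenEigenspace, LinearMap.mem_ker, zero_smul, sub_zero]
    constructor
    · rintro ⟨k, hk⟩
      induction k with
      | zero =>
        have : v = 0 := by simpa using hk
        rw [this, map_zero]
      | succ k ih =>
        cases k with
        | zero => simpa using hk
        | succ k =>
          apply ih
          rw [pow_succ', pow_succ'] at hk
          rw [pow_succ']
          exact hstep _ hk
    · intro hv
      exact ⟨1, by simpa using hv⟩
  have hmul : Polynomial.rootMultiplicity 0 C.charpoly =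
      Module.finrank (RatFunc F) (LinearMap.ker C.mulVecLin) := by
    rw [← hker, LinearMap.finrank_maxGenEigenspace_eq, charpoly_mulVecLin]
  have hrn := C.mulVecLin.finrank_range_add_finrank_ker
  rw [Module.finrank_fintype_fun_eq_card, Fintype.card_fin, ← hmul] at hrn
  change C.rank + _ = _ at hrn
  omega
end

section
/- Let F be a field, m, n natural numbers, and A an m×n matrix over F. Let C = χ · S, where S is the (m+n)×(m+n) symmetric block matrix [[0, A],[Aᵀ, 0]] with entries embedded into F(X), and χ is the diagonal matrix over F(X) with diagonal entries X^0, …, X^{m+n−1}. Then the kernel and the image of C (as a linear map on F(X)^{m+n} by matrix–vector multiplication) intersect trivially: for every vector v over F(X), if C·(C·v) = 0 then C·v = 0. -/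
open Matrix Polynomial

theorem mulmuley_aux {F : Type*} [Field F] {N : ℕ} (M : Matrix (Fin N) (Fin N) F)
    (hM : ∀ i j, M i j = M j i) (p w : Fin N → F[X])
    (hw : ∀ i, w i = ∑ j, Polynomial.C (M i j) * p j)
    (h : ∀ k, ∑ i, Polynomial.C (M k i) * (X ^ (i : ℕ) * w i) = 0) : ∀ i, w i = 0 := by
  classical
  by_contra! hne
  obtain ⟨i1, hi1⟩ := hne
  obtain ⟨i0, -, hi0⟩ := Finset.exists_max_image Finset.univ (fun i => (w i).degree)
    ⟨i1, Finset.mem_univ _⟩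
  have hw0 : w i0 ≠ 0 := by
    intro h0
    have := hi0 i1 (Finset.mem_univ _)
    simp only [h0, degree_zero, le_bot_iff, degree_eq_bot] at this
    exact hi1 this
  set d := (w i0).natDegree with hd
  have hle : ∀ i, (w i).natDegree ≤ d := fun i =>
    natDegree_le_natDegree (hi0 i (Finset.mem_univ _))
  have hu0 : (w i0).coeff d ≠ 0 := by
    rw [hd]; exact leadingCoeff_ne_zero.mpr hw0
  obtain ⟨j, hj, hjmax⟩ := Finset.exists_max_image
    (Finset.univ.filter (fun i => (w i).coeff d ≠ 0)) id ⟨i0, by simp [hu0]⟩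
  simp only [Finset.mem_filter, Finset.mem_univ, true_and, id] at hj hjmax
  have hu : ∀ i, (w i).coeff d = ∑ k, M i k * (p k).coeff d := by
    intro i
    rw [hw i, finsetSum_coeff]
    simp
  have key : ∑ i, Polynomial.C ((w i).coeff d) * (X ^ (i : ℕ) * w i) = 0 := by
    calc _ = ∑ i, ∑ k, Polynomial.C ((p k).coeff d) *
            (Polynomial.C (M k i) * (X ^ (i : ℕ) * w i)) := by
          refine Finset.sum_congr rfl fun i _ => ?_
          rw [hu i, map_sum, Finset.sum_mul]
          refine Finset.sum_congr rfl fun k _ => ?_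
          rw [hM i k, map_mul]; ring
      _ = 0 := by
          rw [Finset.sum_comm]
          refine Finset.sum_eq_zero fun k _ => ?_
          rw [← Finset.mul_sum, h k, mul_zero]
  have hc := congrArg (fun q => q.coeff (d + (j : ℕ))) key
  simp only [finsetSum_coeff, coeff_C_mul, coeff_zero] at hc
  rw [Finset.sum_eq_single j] at hc
  · rw [coeff_X_pow_mul] at hc
    exact hj (mul_self_eq_zero.mp hc)
  · intro i _ hij
    by_cases hi : (w i).coeff d = 0
    · rw [hi, zero_mul]
    · have hlt : (i : ℕ) < j := lt_of_le_of_ne (hjmax i hi) (fun e => hij (Fin.ext e))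
      rw [coeff_X_pow_mul', if_pos (by omega),
        coeff_eq_zero_of_natDegree_lt (p := w i) (n := d + (j : ℕ) - (i : ℕ)) (by have := hle i; omega), mul_zero]
  · simp

theorem mulmuley_aux2 {F : Type*} [Field F] {N : ℕ} (M : Matrix (Fin N) (Fin N) F)
    (hM : ∀ i j, M i j = M j i) (v : Fin N → RatFunc F)
    (h : ∀ k, ∑ i, algebraMap F (RatFunc F) (M k i) * ((RatFunc.X : RatFunc F) ^ (i : ℕ) *
      ∑ j, algebraMap F (RatFunc F) (M i j) * v j) = 0) :
    ∀ i, ∑ j, algebraMap F (RatFunc F) (M i j) * v j = 0 := by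
  obtain ⟨b, hb⟩ := IsLocalization.exist_integer_multiples_of_finite (nonZeroDivisors F[X]) v
  choose p hp using hb
  have hb0 : algebraMap F[X] (RatFunc F) b ≠ 0 := by
    simp
  have hw : ∀ i, algebraMap F[X] (RatFunc F) (∑ j, Polynomial.C (M i j) * p j) =
      algebraMap F[X] (RatFunc F) b * ∑ j, algebraMap F (RatFunc F) (M i j) * v j := by
    intro i
    rw [map_sum, Finset.mul_sum]
    refine Finset.sum_congr rfl fun j _ => ?_
    rw [map_mul, hp j, Algebra.smul_def, RatFunc.algebraMap_C, RatFunc.algebraMap_eq_C]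
    ring
  have := mulmuley_aux M hM p _ (fun i => rfl) (by
    intro k
    apply RatFunc.algebraMap_injective F
    rw [map_sum, map_zero, ← mul_zero (algebraMap F[X] (RatFunc F) b), ← h k, Finset.mul_sum]
    refine Finset.sum_congr rfl fun i _ => ?_
    rw [map_mul, map_mul, hw, map_pow, RatFunc.algebraMap_X, RatFunc.algebraMap_C,
      RatFunc.algebraMap_eq_C]
    ring)
  intro i
  have h1 := hw i
  rw [this i, map_zero] at h1
  exact (mul_eq_zero.mp h1.symm).resolve_left hb0

/-- The kernel and image of `C = χ * S` intersect trivially: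
if `C · (C · v) = 0` then `C · v = 0`. -/
theorem mulmuley_ker_inter_im (F : Type*) [Field F] (m n : ℕ) (A : Matrix (Fin m) (Fin n) F)
    (S : Matrix (Fin (m + n)) (Fin (m + n)) (RatFunc F))
    (hS : S = Matrix.reindex finSumFinEquiv finSumFinEquiv
      ((Matrix.fromBlocks 0 A Aᵀ 0).map (algebraMap F (RatFunc F))))
    (χ : Matrix (Fin (m + n)) (Fin (m + n)) (RatFunc F))
    (hχ : χ = Matrix.diagonal (fun i : Fin (m + n) => (RatFunc.X : RatFunc F) ^ (i : ℕ)))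
    (C : Matrix (Fin (m + n)) (Fin (m + n)) (RatFunc F))
    (hC : C = χ * S) :
    ∀ v : Fin (m + n) → RatFunc F, C.mulVec (C.mulVec v) = 0 → C.mulVec v = 0 := by
  intro v hv
  set M : Matrix (Fin (m + n)) (Fin (m + n)) F :=
    Matrix.reindex finSumFinEquiv finSumFinEquiv (Matrix.fromBlocks 0 A Aᵀ 0) with hMdef
  have hMt : Mᵀ = M := by
    simp [hMdef, Matrix.fromBlocks_transpose]
  have hM : ∀ i j, M i j = M j i := fun i j => congrFun (congrFun hMt.symm i) j
  have hSM : ∀ i j, S i j = algebraMap F (RatFunc F) (M i j) := by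
    intro i j; rw [hS]; rfl
  have hCv : ∀ u i, C.mulVec u i = (RatFunc.X : RatFunc F) ^ (i : ℕ) *
      ∑ j, algebraMap F (RatFunc F) (M i j) * u j := by
    intro u i
    rw [hC, hχ, ← Matrix.mulVec_mulVec, Matrix.mulVec_diagonal]
    simp only [Matrix.mulVec, dotProduct, hSM]
  have hfin := mulmuley_aux2 M hM v (by
    intro k
    have h1 := congrFun hv k
    rw [hCv] at h1
    simp only [hCv, Pi.zero_apply] at h1
    exact (mul_eq_zero.mp h1).resolve_left (pow_ne_zero _ RatFunc.X_ne_zero))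
  funext i
  rw [hCv, hfin i, mul_zero]; rfl
end
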